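/- arXiv:2006.13475 — 2 statements merged into one kernel-verified Lean document; each statement's English description precedes it below -/
import Mathlib

section
/- Let n ≥ 1 be an integer, T ∈ (0, ∞], and A > 0. Let J : [0,∞) × (0,T) → [0,∞) be a function satisfying: (i) J(R,t) ≤ J(r,t) whenever 0 ≤ r ≤ R (nonincreasing in the first variable); (ii) J(0,t) ≤ A t^{−n/2} for all t ∈ (0,T); (iii) for each r > 0, J(r,t) → 0 as t → 0⁺; and (iv) J(R,t) ≤ J(r,τ) + A τ^{−n/2} exp(−(R−r)²/(2(t−τ))) for all 0 ≤ r < R and 0 < τ < t < T. Then for every γ > 1 there exists a constant D₀ > 2, depending only on γ, such that J(R,t) ≤ 2 γ^{n/2} A t^{−n/2} exp(−R²/(D₀ t)) for all R > 0 and t ∈ (0,T). -/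
open Real Filter

/-- Abstract form of Lemma 4.2 (Grigor'yan's iteration argument): if
`J(R,t)` is nonnegative, nonincreasing in `R`, satisfies `J(0,t) ≤ A t^{−n/2}`,
vanishes as `t → 0⁺` for each `R > 0`, and satisfies the comparison inequality
`J(R,t) ≤ J(r,τ) + A τ^{−n/2} e^{−(R−r)²/(2(t−τ))}`, then for every `γ > 1`
there is `D₀ = D₀(γ) > 2` with
`J(R,t) ≤ 2 γ^{n/2} A t^{−n/2} e^{−R²/(D₀ t)}` for all `R > 0`, `t ∈ (0,T)`.
Here `T ∈ (0,∞]` is encoded as `T : ℝ≥0∞` with `0 < T`. -/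
theorem grigoryan_iteration :
    ∀ γ : ℝ, 1 < γ → ∃ D₀ : ℝ, 2 < D₀ ∧
      ∀ (n : ℕ), 1 ≤ n → ∀ (T : ENNReal), 0 < T → ∀ (A : ℝ), 0 < A →
      ∀ (J : ℝ → ℝ → ℝ),
        (∀ R t, 0 ≤ J R t) →
        (∀ r R t, 0 ≤ r → r ≤ R → 0 < t → ENNReal.ofReal t < T → J R t ≤ J r t) →
        (∀ t, 0 < t → ENNReal.ofReal t < T → J 0 t ≤ A * t ^ (-(n : ℝ) / 2)) →
        (∀ r, 0 < r →
          Tendsto (fun t => J r t) (nhdsWithin 0 (Set.Ioi 0)) (nhds 0)) →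
        (∀ r R τ t, 0 ≤ r → r < R → 0 < τ → τ < t → ENNReal.ofReal t < T →
          J R t ≤ J r τ + A * τ ^ (-(n : ℝ) / 2) *
            Real.exp (-(R - r) ^ 2 / (2 * (t - τ)))) →
        ∀ R t, 0 < R → 0 < t → ENNReal.ofReal t < T →
          J R t ≤ 2 * γ ^ ((n : ℝ) / 2) * A * t ^ (-(n : ℝ) / 2) *
            Real.exp (-R ^ 2 / (D₀ * t)) := by
  intro γ hγ
  obtain ⟨p, hp1, hpγ⟩ : ∃ p : ℝ, 1 < p ∧ p ^ 4 = γ := by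
    refine ⟨γ ^ ((1:ℝ) / 4), Real.one_lt_rpow hγ (by norm_num), ?_⟩
    rw [← Real.rpow_natCast, ← Real.rpow_mul (by linarith)]
    norm_num
  have hp0 : 0 < p := by linarith
  obtain ⟨m, hm0, hm1, hmp⟩ : ∃ m : ℝ, 0 < m ∧ m ≤ 1 ∧ m ≤ p ^ 2 - 1 :=
    ⟨min 1 (p ^ 2 - 1), lt_min one_pos (by nlinarith), min_le_left _ _, min_le_right _ _⟩
  have hq0 : 0 < p⁻¹ := inv_pos.mpr hp0
  have hq1 : p⁻¹ < 1 := inv_lt_one_of_one_lt₀ hp1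
  obtain ⟨q, hq⟩ : ∃ q, q = p⁻¹ := ⟨_, rfl⟩
  rw [← hq] at hq0 hq1
  have hqp : q * p = 1 := by rw [hq]; field_simp
  obtain ⟨a, ha⟩ : ∃ a, a = (1 - q) ^ 2 / 8 * m := ⟨_, rfl⟩
  have h1q : 0 < (1 - q) ^ 2 := by have : 0 < 1 - q := by linarith
                                   positivity
  have ha0 : 0 < a := by rw [ha]; positivity
  have ha1 : a < 1 / 2 := by
    have : (1 - q) ^ 2 ≤ 1 := by nlinarith
    rw [ha]; nlinarith
  have hbern : ∀ k : ℕ, ((k:ℝ) + 1) * m ≤ (p ^ 2) ^ k := by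
    intro k
    induction k with
    | zero => simpa using hm1
    | succ k ih =>
      have h1 : 1 ≤ (p ^ 2) ^ k := one_le_pow₀ (by nlinarith)
      rw [pow_succ]; push_cast
      nlinarith
  refine ⟨1 / a, by rw [lt_div_iff₀ ha0]; linarith, ?_⟩
  intro n hn T hT A hA J hJ0 hmono h0 hlim hcomp R t hR ht htT
  have hγ0 : 0 < γ := by linarith
  obtain ⟨g, hg⟩ : ∃ g, g = γ ^ ((n : ℝ) / 2) := ⟨_, rfl⟩
  have hg0 : 0 < g := by rw [hg]; positivity
  obtain ⟨E, hE⟩ : ∃ E, E = Real.exp (-R ^ 2 / (1 / a * t)) := ⟨_, rfl⟩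
  have hE0 : 0 < E := by rw [hE]; positivity
  obtain ⟨S, hS⟩ : ∃ S, S = t ^ (-(n : ℝ) / 2) := ⟨_, rfl⟩
  have hS0 : 0 < S := by rw [hS]; positivity
  rw [← hg, ← hE, ← hS]
  rcases le_or_gt 1 (2 * (g * E)) with hc | hc
  · have h1 := hmono 0 R t le_rfl hR.le ht htT
    have h2 := h0 t ht htT
    rw [← hS] at h2
    have : 0 < A * S := by positivity
    nlinarith
  have hγk : ∀ k : ℕ, 0 < γ ^ k := fun k => by positivity
  have htk : ∀ k : ℕ, ENNReal.ofReal (t / γ ^ k) < T := fun k =>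
    lt_of_le_of_lt (ENNReal.ofReal_le_ofReal
      (div_le_self ht.le (one_le_pow₀ hγ.le))) htT
  have hpw : ∀ k : ℕ, (t / γ ^ k) ^ (-(n : ℝ) / 2) = S * g ^ k := by
    intro k
    rw [Real.div_rpow ht.le (hγk k).le, ← hS, hg, neg_div, Real.rpow_neg (hγk k).le,
      div_inv_eq_mul, ← Real.rpow_natCast, ← Real.rpow_natCast, ← Real.rpow_mul hγ0.le,
      ← Real.rpow_mul hγ0.le, mul_comm (k:ℝ)]
  have hexp : ∀ k : ℕ, Real.exp (-(R / 2 * (1 + q ^ k) - R / 2 * (1 + q ^ (k+1))) ^ 2 /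
      (2 * (t / γ ^ k - t / γ ^ (k+1)))) ≤ E ^ (k+1) := by
    intro k
    rw [hE, ← Real.exp_nat_mul]
    apply Real.exp_le_exp.mpr
    have hd : 0 < t / γ ^ k - t / γ ^ (k+1) := by
      have := div_lt_div_of_pos_left ht (hγk k) (pow_lt_pow_right₀ hγ (Nat.lt_succ_self k))
      exact sub_pos.mpr this
    have hd2 : t / γ ^ k - t / γ ^ (k+1) ≤ t / γ ^ k := by
      have : 0 < t / γ ^ (k+1) := by positivity
      linarith
    have e1 : ((k+1 : ℕ) : ℝ) * (-R ^ 2 / (1 / a * t)) = -(((k:ℝ)+1) * a * (R ^ 2 / t)) := by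
      push_cast; field_simp
    rw [e1, neg_div]
    apply neg_le_neg
    have e2 : (R / 2 * (1 + q ^ k) - R / 2 * (1 + q ^ (k+1))) ^ 2 / (2 * (t / γ ^ k))
        = (1 - q) ^ 2 / 8 * (p ^ 2) ^ k * (R ^ 2 / t) := by
      have : (q ^ k) ^ 2 * γ ^ k = (p ^ 2) ^ k := by
        have h : q ^ 2 * γ = p ^ 2 := by
          rw [← hpγ]; linear_combination (q * p + 1) * p ^ 2 * hqp
        rw [← h, mul_pow]; ring
      rw [← this]
      have := hγk k
      field_simp
      ring
    calc _ ≤ (1 - q) ^ 2 / 8 * (p ^ 2) ^ k * (R ^ 2 / t) := by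
          apply mul_le_mul_of_nonneg_right _ (by positivity)
          have := mul_le_mul_of_nonneg_left (hbern k) (by positivity : 0 ≤ (1 - q) ^ 2 / 8)
          rw [ha]; linarith
      _ ≤ _ := by
          rw [← e2]
          exact div_le_div_of_nonneg_left (by positivity) (by positivity) (by linarith)
  have hstep : ∀ k : ℕ, J (R / 2 * (1 + q ^ k)) (t / γ ^ k) ≤
      J (R / 2 * (1 + q ^ (k+1))) (t / γ ^ (k+1)) + A * S * (g * E) * (1/2) ^ k := by
    intro k
    have hqk : q ^ (k+1) < q ^ k := pow_lt_pow_right_of_lt_one₀ hq0 hq1 (Nat.lt_succ_self k)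
    have h := hcomp (R / 2 * (1 + q ^ (k+1))) (R / 2 * (1 + q ^ k)) (t / γ ^ (k+1)) (t / γ ^ k)
      (by positivity) (by nlinarith) (by positivity)
      (div_lt_div_of_pos_left ht (hγk k) (pow_lt_pow_right₀ hγ (Nat.lt_succ_self k))) (htk k)
    refine h.trans (add_le_add le_rfl ?_)
    rw [hpw]
    calc _ ≤ A * (S * g ^ (k+1)) * E ^ (k+1) :=
          mul_le_mul_of_nonneg_left (hexp k) (by positivity)
      _ = A * S * (g * E) * (g * E) ^ k := by rw [mul_pow]; ring
      _ ≤ _ := by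
          apply mul_le_mul_of_nonneg_left _ (by positivity)
          exact pow_le_pow_left₀ (by positivity) (by linarith) k
  have hiter : ∀ N : ℕ, J R t ≤ J (R / 2 * (1 + q ^ N)) (t / γ ^ N) +
      A * S * (g * E) * (2 - 2 * (1/2) ^ N) := by
    intro N
    induction N with
    | zero =>
      have : R / 2 * (1 + 1) = R := by ring
      simp [this]
    | succ k ih =>
      have := hstep k
      rw [pow_succ (1/2 : ℝ)]
      linarith
  have hb : ∀ N : ℕ, J R t ≤ J (R / 2) (t / γ ^ N) + A * S * (g * E) * 2 := by
    intro N
    have h1 := hmono (R / 2) (R / 2 * (1 + q ^ N)) (t / γ ^ N) (by positivity)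
      (by have : 0 < q ^ N := by positivity
          nlinarith) (by positivity) (htk N)
    have h2 := hiter N
    have h3 : 0 < A * S * (g * E) * (1/2) ^ N := by positivity
    linarith
  have ht0 : Tendsto (fun N : ℕ => t / γ ^ N) atTop (nhdsWithin 0 (Set.Ioi 0)) := by
    refine tendsto_nhdsWithin_iff.mpr ⟨?_, Eventually.of_forall fun N => div_pos ht (hγk N)⟩
    exact Tendsto.div_atTop tendsto_const_nhds (tendsto_pow_atTop_atTop_of_one_lt hγ)
  have hl := ((hlim (R / 2) (by positivity)).comp ht0).add_const (A * S * (g * E) * 2)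
  have := ge_of_tendsto' hl hb
  linarith
end

section
/- Let (X, Σ, ν) be a measure space, let w : X → [0, ∞] and ρ : X → [0, ∞) be measurable, and let B ≥ 0, a > 0, and b ≥ 5a be real numbers. Suppose that for every R ≥ 0, ∫_{{x : ρ(x) ≥ R}} w dν ≤ B exp(−R²/a). Then ∫_X w · exp(ρ²/b) dν ≤ 4B. -/
open Real MeasureTheory

/-- Abstract form of Step One in the proof of Proposition 4.1: if
`∫_{ρ ≥ R} w dν ≤ B e^{−R²/a}` for every `R ≥ 0`, and `b ≥ 5a`, then
`∫ w e^{ρ²/b} dν ≤ 4B`. -/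
theorem weighted_energy_bound {X : Type*} [MeasurableSpace X] (ν : Measure X)
    (w : X → ENNReal) (hw : Measurable w)
    (ρ : X → ℝ) (hρ : Measurable ρ) (hρnn : ∀ x, 0 ≤ ρ x)
    (B a b : ℝ) (hB : 0 ≤ B) (ha : 0 < a) (hb : 5 * a ≤ b)
    (h : ∀ R : ℝ, 0 ≤ R →
      (∫⁻ x in {x | R ≤ ρ x}, w x ∂ν) ≤ ENNReal.ofReal (B * Real.exp (-R ^ 2 / a))) :
    (∫⁻ x, w x * ENNReal.ofReal (Real.exp (ρ x ^ 2 / b)) ∂ν) ≤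
      ENNReal.ofReal (4 * B) := by
  have hb0 : 0 < b := by linarith
  have hl : 0 < Real.log 2 := Real.log_pos (by norm_num)
  set r : ℕ → ℝ := fun n => Real.sqrt (n * b * Real.log 2) with hr
  have hr2 : ∀ n, r n ^ 2 = n * b * Real.log 2 := fun n => Real.sq_sqrt (by positivity)
  have hms : ∀ n, MeasurableSet {x | r n ≤ ρ x} := fun n => measurableSet_le measurable_const hρ
  have hpt : ∀ x, w x * ENNReal.ofReal (Real.exp (ρ x ^ 2 / b)) ≤
      ∑' n : ℕ, Set.indicator {x | r n ≤ ρ x} (fun x => ENNReal.ofReal (2 ^ (n + 1)) * w x) x := by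
    intro x
    set n := ⌊ρ x ^ 2 / b / Real.log 2⌋₊ with hn
    refine le_trans ?_ (ENNReal.le_tsum n)
    have h1 : (n : ℝ) ≤ ρ x ^ 2 / b / Real.log 2 := Nat.floor_le (by positivity)
    have h2 : ρ x ^ 2 / b / Real.log 2 < n + 1 := Nat.lt_floor_add_one _
    rw [le_div_iff₀ hl, le_div_iff₀ hb0] at h1
    rw [div_lt_iff₀ hl] at h2
    have hx : x ∈ {x | r n ≤ ρ x} := by
      refine (Real.sqrt_le_left (hρnn x)).2 ?_
      linarith
    rw [Set.indicator_of_mem hx, mul_comm]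
    gcongr
    calc Real.exp (ρ x ^ 2 / b) ≤ Real.exp (((n + 1 : ℕ) : ℝ) * Real.log 2) := by
          apply Real.exp_le_exp.2
          push_cast
          exact h2.le
      _ = 2 ^ (n + 1) := by
          rw [Real.exp_nat_mul, Real.exp_log (by norm_num)]
  have hterm : ∀ n : ℕ, (∫⁻ x, Set.indicator {x | r n ≤ ρ x}
      (fun x => ENNReal.ofReal (2 ^ (n + 1)) * w x) x ∂ν) ≤
      ENNReal.ofReal (2 * B * (1 / 2) ^ n) := by
    intro n
    rw [lintegral_indicator (hms n), lintegral_const_mul _ hw]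
    refine (mul_le_mul_right (h (r n) (Real.sqrt_nonneg _)) _).trans ?_
    rw [← ENNReal.ofReal_mul (by positivity)]
    apply ENNReal.ofReal_le_ofReal
    have he : Real.exp (-r n ^ 2 / a) ≤ (1 / 4) ^ n := by
      have : ((1 : ℝ) / 4) ^ n = Real.exp (n * (-(2 * Real.log 2))) := by
        rw [Real.exp_nat_mul, Real.exp_neg, mul_comm 2, Real.exp_mul, Real.exp_log (by norm_num)]
        norm_num
      rw [this]
      apply Real.exp_le_exp.2
      rw [hr2, div_le_iff₀ ha]
      have : 0 ≤ (n : ℝ) * Real.log 2 := by positivity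
      nlinarith
    calc (2 : ℝ) ^ (n + 1) * (B * Real.exp (-r n ^ 2 / a))
        ≤ 2 ^ (n + 1) * (B * (1 / 4) ^ n) := by gcongr
      _ = 2 * B * (2 * (1 / 4)) ^ n := by rw [mul_pow]; ring
      _ = 2 * B * (1 / 2) ^ n := by norm_num
  calc _ ≤ ∫⁻ x, ∑' n : ℕ, Set.indicator {x | r n ≤ ρ x}
        (fun x => ENNReal.ofReal (2 ^ (n + 1)) * w x) x ∂ν := lintegral_mono hpt
    _ = ∑' n : ℕ, ∫⁻ x, Set.indicator {x | r n ≤ ρ x}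
        (fun x => ENNReal.ofReal (2 ^ (n + 1)) * w x) x ∂ν :=
        lintegral_tsum fun n => ((hw.const_mul _).indicator (hms n)).aemeasurable
    _ ≤ ∑' n : ℕ, ENNReal.ofReal (2 * B * (1 / 2) ^ n) := ENNReal.tsum_le_tsum hterm
    _ = ENNReal.ofReal (4 * B) := by
        rw [← ENNReal.ofReal_tsum_of_nonneg (fun n => by positivity)
          (summable_geometric_two.mul_left _), tsum_mul_left, tsum_geometric_two]
        congr 1
        ring
end
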